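/- arXiv:2204.03587 — 2 statements merged into one kernel-verified Lean document; each statement's English description precedes it below -/
import Mathlib

section
/- Let M = T × [0,1] with T = ℝ/(2πℤ). For every ω_b ∈ L^∞(M) and every δ > 0 there exists ε₀ > 0 (depending on ω_b and δ) such that for all 0 < ε < ε₀ the function ξ := ω_b + δ ε^{-2} 𝟙_{[π−ε,π+ε]}(x₁) 𝟙_{[1/2−ε,1/2+ε]}(x₂) satisfies ‖ξ − ω_b‖_{L¹(M)} = 4δ, and there exists NO W ∈ L^∞([0,1]) such that the shear flow ω_W(x₁,x₂) := W(x₂) satisfies simultaneously: (a) ω_W = Kξ almost everywhere for some bistochastic kernel K on M, (b) E(ω_W) = E(ξ), and (c) 𝖬(ω_W) = 𝖬(ξ). -/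
open MeasureTheory ProbabilityTheory

noncomputable section

/-- A bistochastic kernel on a measure space `(X, μ)`. -/
def IsBistochastic {X : Type*} [MeasurableSpace X] (μ : Measure X)
    (κ : Kernel X X) : Prop :=
  IsMarkovKernel κ ∧ ∀ A : Set X, MeasurableSet A → ∫⁻ x, κ x A ∂μ = μ A

/-- `(Kω)(x) := ∫ ω(y) dκ_x(y)`. -/
def kernApply {X : Type*} [MeasurableSpace X]
    (κ : Kernel X X) (ω : X → ℝ) (x : X) : ℝ :=
  ∫ y, ω y ∂(κ x)

/-- The periodic channel `M = T × [0,1]`, `T = ℝ/(2πℤ)`, represented as the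
fundamental domain `(0, 2π] × [0,1]` in `ℝ²`. -/
def channel : Set (ℝ × ℝ) := Set.Ioc 0 (2 * Real.pi) ×ˢ Set.Icc (0:ℝ) 1

/-- Lebesgue measure on the channel. -/
def μM : Measure (ℝ × ℝ) := volume.restrict channel

/-- The `k`-th Fourier coefficient in the periodic variable `x₁`:
`ω̂_k(x₂) = (2π)⁻¹ ∫₀^{2π} e^{-i k x₁} ω(x₁, x₂) dx₁`. -/
def fourierCoef (ω : ℝ × ℝ → ℝ) (k : ℤ) (y : ℝ) : ℂ :=
  (1 / (2 * Real.pi)) * ∫ x₁ in (0:ℝ)..(2 * Real.pi),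
    Complex.exp (-(Complex.I * k * x₁)) * (ω (x₁, y) : ℂ)

/-- The Green kernels of the channel with Dirichlet boundary conditions. -/
def green (k : ℤ) (y z : ℝ) : ℝ :=
  if k = 0 then -(min y z * (1 - max y z))
  else -(Real.sinh (k * min y z) * Real.sinh (k * (1 - max y z)) / (k * Real.sinh k))

/-- The (Dirichlet) kinetic energy
`E(ω) = -π Σ_k ∫₀¹∫₀¹ G_k(y,z) ω̂_k(y) conj(ω̂_k(z)) dy dz`. -/
def energy (ω : ℝ × ℝ → ℝ) : ℝ :=
  -Real.pi * ∑' k : ℤ, (∫ y in (0:ℝ)..1, ∫ z in (0:ℝ)..1,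
      ((green k y z : ℂ) * fourierCoef ω k y * (starRingEnd ℂ) (fourierCoef ω k z))).re

/-- The linear momentum `𝖬(ω) = -∫_M x₂ ω dλ`. -/
def momentum (ω : ℝ × ℝ → ℝ) : ℝ := -∫ x, x.2 * ω x ∂μM

/-- The perturbed vorticity `ξ = ω_b + δ ε⁻² 𝟙_{[π-ε,π+ε]}(x₁) 𝟙_{[1/2-ε,1/2+ε]}(x₂)`. -/
def pertVort (ωb : ℝ × ℝ → ℝ) (δ ε : ℝ) : ℝ × ℝ → ℝ := fun x =>
  ωb x + δ / ε ^ 2 *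
    (Set.Icc (Real.pi - ε) (Real.pi + ε)).indicator (fun _ => (1:ℝ)) x.1 *
    (Set.Icc (1 / 2 - ε) (1 / 2 + ε)).indicator (fun _ => (1:ℝ)) x.2

/-- The decreasing homogeneous solution `s ↦ sinh (k (1 - s))` (or `1 - s` when `k = 0`) is
`profile k (1 - s)`. -/
def profile (k : ℤ) (s : ℝ) : ℝ := if k = 0 then s else Real.sinh (k * s)

/-- A square root of the Green kernel: `-G_k(y,z) = ∫₀¹ φ_k(t,y) φ_k(t,z) dt`. -/
def greenRoot (k : ℤ) (t y : ℝ) : ℝ :=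
  if t ≤ y ∧ y ≤ 1 then profile k (1 - y) / profile k (1 - t) else 0

lemma profile_neg (k : ℤ) (s : ℝ) : profile (-k) s = if k = 0 then s else -profile k s := by
  by_cases h : k = 0 <;> simp [profile, h]

lemma continuous_profile (k : ℤ) : Continuous (profile k) := by
  unfold profile
  split_ifs <;> fun_prop

lemma greenRoot_neg (k : ℤ) : greenRoot (-k) = greenRoot k := by
  funext t y
  by_cases h : k = 0
  · simp [h]
  · simp [greenRoot, profile_neg, h, neg_div_neg_eq]

lemma greenRoot_abs (k : ℤ) : greenRoot |k| = greenRoot k := by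
  rcases abs_choice k with h | h <;> rw [h]
  exact greenRoot_neg k

lemma sinh_div_sinh_le_exp {a b : ℝ} (ha : 0 < a) (hab : b ≤ a) :
    Real.sinh b / Real.sinh a ≤ Real.exp (b - a) := by
  rw [div_le_iff₀ (Real.sinh_pos_iff.2 ha), Real.sinh_eq, Real.sinh_eq]
  have h1 : Real.exp (b - a) * Real.exp a = Real.exp b := by rw [← Real.exp_add]; ring_nf
  have h2 : Real.exp (b - a) * Real.exp (-a) ≤ Real.exp (-b) := by
    rw [← Real.exp_add]; exact Real.exp_le_exp.2 (by linarith)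
  nlinarith

lemma greenRoot_nonneg (k : ℤ) (t y : ℝ) : 0 ≤ greenRoot k t y := by
  rw [← greenRoot_abs]
  unfold greenRoot profile
  split_ifs with h h0
  · exact div_nonneg (by linarith) (by linarith)
  · have hk : (0 : ℝ) ≤ ((|k| : ℤ) : ℝ) := by exact_mod_cast abs_nonneg k
    exact div_nonneg (Real.sinh_nonneg_iff.2 (mul_nonneg hk (by linarith)))
      (Real.sinh_nonneg_iff.2 (mul_nonneg hk (by linarith)))
  · exact le_rfl

lemma greenRoot_le_exp (k : ℤ) {t y : ℝ} (hty : t ≤ y) :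
    greenRoot k t y ≤ Real.exp (-(|(k : ℝ)| * (y - t))) := by
  rw [← greenRoot_abs]
  unfold greenRoot profile
  split_ifs with h h0
  · have : (k : ℝ) = 0 := by exact_mod_cast abs_eq_zero.1 h0
    rw [this]
    simpa using div_le_one_of_le₀ (by linarith) (by linarith)
  · have hk : (0 : ℝ) < |(k : ℝ)| := by
      rw [abs_pos]; exact_mod_cast fun h => h0 (by simp [h])
    push_cast
    rcases (show t ≤ 1 by linarith).eq_or_lt with rfl | ht
    · simp [Real.exp_nonneg]
    · refine (sinh_div_sinh_le_exp (mul_pos hk (by linarith))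
        (mul_le_mul_of_nonneg_left (by linarith) hk.le)).trans_eq ?_
      ring_nf
  · exact Real.exp_nonneg _

lemma greenRoot_of_lt (k : ℤ) {t y : ℝ} (h : y < t) : greenRoot k t y = 0 :=
  if_neg fun h' => by linarith [h'.1]

lemma greenRoot_le_one (k : ℤ) (t y : ℝ) : greenRoot k t y ≤ 1 := by
  rcases le_or_gt t y with h | h
  · refine (greenRoot_le_exp k h).trans (Real.exp_le_one_iff.2 ?_)
    have := mul_nonneg (abs_nonneg (k : ℝ)) (sub_nonneg.2 h)
    linarith
  · simp [greenRoot_of_lt k h]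

lemma measurable_greenRoot (k : ℤ) : Measurable (fun p : ℝ × ℝ => greenRoot k p.1 p.2) := by
  have hp := (continuous_profile k).measurable
  unfold greenRoot
  refine Measurable.ite ?_ (by fun_prop) measurable_const
  exact (measurableSet_le measurable_fst measurable_snd).inter
    (measurableSet_le measurable_snd measurable_const)

lemma hasDerivAt_profile_ratio {k : ℤ} (hk : k ≠ 0) {t : ℝ} (ht : t < 1) :
    HasDerivAt (fun t : ℝ => Real.sinh (k * t) / Real.sinh (k * (1 - t)) / (k * Real.sinh k))
      (1 / Real.sinh (k * (1 - t)) ^ 2) t := by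
  have hk' : (k : ℝ) ≠ 0 := by exact_mod_cast hk
  have hs : Real.sinh (k * (1 - t)) ≠ 0 := by
    rw [Ne, Real.sinh_eq_zero]; exact mul_ne_zero hk' (by linarith)
  have hs' : Real.sinh k ≠ 0 := by rwa [Ne, Real.sinh_eq_zero]
  have h1 : HasDerivAt (fun t : ℝ => Real.sinh (k * t)) (Real.cosh (k * t) * k) t := by
    simpa using ((hasDerivAt_id t).const_mul (k : ℝ)).sinh
  have h2 : HasDerivAt (fun t : ℝ => Real.sinh (k * (1 - t)))
      (Real.cosh (k * (1 - t)) * (-k)) t := by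
    simpa using (((hasDerivAt_id t).const_sub 1).const_mul (k : ℝ)).sinh
  refine ((h1.div h2 hs).div_const (k * Real.sinh k)).congr_deriv ?_
  have h3 : Real.sinh k = Real.sinh (k * t) * Real.cosh (k * (1 - t)) +
      Real.cosh (k * t) * Real.sinh (k * (1 - t)) := by
    rw [← Real.sinh_add]; ring_nf
  rw [div_div, div_eq_div_iff (by positivity) (by positivity), h3]
  ring

lemma integral_inv_profile_sq (k : ℤ) {m : ℝ} (h0 : 0 ≤ m) (h1 : m < 1) :
    ∫ t in (0:ℝ)..m, 1 / profile k (1 - t) ^ 2 =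
      if k = 0 then m / (1 - m)
      else Real.sinh (k * m) / Real.sinh (k * (1 - m)) / (k * Real.sinh k) := by
  have hcont : ContinuousOn (fun t => 1 / profile k (1 - t) ^ 2) (Set.uIcc 0 m) := by
    rw [Set.uIcc_of_le h0]
    refine continuousOn_const.div
      (((continuous_profile k).comp (by fun_prop)).pow 2).continuousOn fun t ht => ?_
    have : 1 - t ≠ 0 := by linarith [ht.2]
    unfold profile
    split_ifs with hk
    · positivity
    · have hk' : (k : ℝ) ≠ 0 := by exact_mod_cast hk
      exact pow_ne_zero _ (by rw [Ne, Real.sinh_eq_zero]; positivity)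
  by_cases hk : k = 0
  · have hd : ∀ t ∈ Set.uIcc 0 m,
        HasDerivAt (fun t : ℝ => 1 / (1 - t)) (1 / profile k (1 - t) ^ 2) t := by
      intro t ht
      rw [Set.uIcc_of_le h0] at ht
      have : 1 - t ≠ 0 := by linarith [ht.2]
      simp only [profile, hk, if_true, one_div]
      exact (((hasDerivAt_id t).const_sub 1).inv this).congr_deriv (by simp)
    rw [intervalIntegral.integral_eq_sub_of_hasDerivAt hd hcont.intervalIntegrable, if_pos hk]
    have : 1 - m ≠ 0 := by linarith
    field_simp
    ring
  · have hd : ∀ t ∈ Set.uIcc 0 m, HasDerivAt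
        (fun t : ℝ => Real.sinh (k * t) / Real.sinh (k * (1 - t)) / (k * Real.sinh k))
        (1 / profile k (1 - t) ^ 2) t := by
      intro t ht
      rw [Set.uIcc_of_le h0] at ht
      simpa [profile, hk] using hasDerivAt_profile_ratio hk (ht.2.trans_lt h1)
    rw [intervalIntegral.integral_eq_sub_of_hasDerivAt hd hcont.intervalIntegrable, if_neg hk]
    simp

lemma green_eq_neg_integral (k : ℤ) {y z : ℝ} (hy : y ∈ Set.Ioo (0:ℝ) 1)
    (hz : z ∈ Set.Ioo (0:ℝ) 1) :
    green k y z = -∫ t in Set.Ioo (0:ℝ) 1, greenRoot k t y * greenRoot k t z := by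
  have hm0 : 0 < min y z := lt_min hy.1 hz.1
  have hm1 : min y z < 1 := (min_le_left _ _).trans_lt hy.2
  have hmM : profile k (1 - y) * profile k (1 - z) =
      profile k (1 - min y z) * profile k (1 - max y z) := by
    rcases le_total y z with h | h <;> simp [h, mul_comm]
  have key : ∫ t in Set.Ioo (0:ℝ) 1, greenRoot k t y * greenRoot k t z =
      profile k (1 - min y z) * profile k (1 - max y z) *
        ∫ t in (0:ℝ)..min y z, 1 / profile k (1 - t) ^ 2 := by
    rw [intervalIntegral.integral_of_le hm0.le, ← integral_const_mul]
    have hsub : Set.Ioc 0 (min y z) ⊆ Set.Ioo (0:ℝ) 1 :=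
      fun t ht => ⟨ht.1, ht.2.trans_lt hm1⟩
    rw [setIntegral_eq_of_subset_of_forall_sdiff_eq_zero measurableSet_Ioo hsub]
    · refine setIntegral_congr_fun measurableSet_Ioc fun t ht => ?_
      have h1 := le_min_iff.1 ht.2
      simp only [greenRoot, h1.1, h1.2, hy.2.le, hz.2.le, and_self, if_true, ← hmM]
      ring
    · intro t ht
      have : min y z < t := by
        by_contra h
        exact ht.2 ⟨ht.1.1, not_lt.1 h⟩
      rcases min_lt_iff.1 this with h | h <;> simp [greenRoot_of_lt k h]
  rw [key, integral_inv_profile_sq k hm0.le hm1]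
  have hne : 1 - min y z ≠ 0 := by linarith
  by_cases hk : k = 0
  · simp only [green, profile, hk, if_true]
    field_simp
  · have hk' : (k : ℝ) ≠ 0 := by exact_mod_cast hk
    have hs : Real.sinh (k * (1 - min y z)) ≠ 0 := by
      rw [Ne, Real.sinh_eq_zero]; exact mul_ne_zero hk' hne
    simp only [green, profile, hk, if_false]
    field_simp

lemma integrable_greenRoot (k : ℤ) (t : ℝ) (μ : Measure ℝ) [IsFiniteMeasure μ] :
    Integrable (greenRoot k t) μ := by
  refine .of_bound ((measurable_greenRoot k).comp
    measurable_prodMk_left).aestronglyMeasurable 1 (.of_forall fun y => ?_)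
  rw [Real.norm_of_nonneg (greenRoot_nonneg _ _ _)]
  exact greenRoot_le_one _ _ _

/-- The measure on the cross-section `(0,1)`. -/
def sectionMeasure : Measure ℝ := volume.restrict (Set.Ioo (0:ℝ) 1)

instance : IsProbabilityMeasure sectionMeasure := ⟨by simp [sectionMeasure]⟩

lemma intervalIntegral_eq_section {E : Type*} [NormedAddCommGroup E] [NormedSpace ℝ E]
    (f : ℝ → E) : ∫ t in (0:ℝ)..1, f t = ∫ t, f t ∂sectionMeasure := by
  rw [intervalIntegral.integral_of_le zero_le_one, integral_Ioc_eq_integral_Ioo, sectionMeasure]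

/-- The transform `u ↦ ∫₀¹ φ_k(t,y) u(y) dy`. -/
def greenTransform (k : ℤ) (u : ℝ → ℂ) (t : ℝ) : ℂ :=
  ∫ y, (greenRoot k t y : ℂ) * u y ∂sectionMeasure

/-- The quadratic form of `-G_k`. -/
def greenForm (k : ℤ) (u : ℝ → ℂ) : ℝ := ∫ t, ‖greenTransform k u t‖ ^ 2 ∂sectionMeasure

lemma greenForm_nonneg (k : ℤ) (u : ℝ → ℂ) : 0 ≤ greenForm k u :=
  integral_nonneg fun _ => by positivity

section Bounded

variable {k : ℤ} {u v : ℝ → ℂ} {C D : ℝ}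

lemma norm_greenRoot_mul_le (hC : ∀ y, ‖u y‖ ≤ C) (t y : ℝ) :
    ‖(greenRoot k t y : ℂ) * u y‖ ≤ C := by
  rw [norm_mul, Complex.norm_real, Real.norm_of_nonneg (greenRoot_nonneg k t y)]
  exact (mul_le_of_le_one_left (norm_nonneg _) (greenRoot_le_one k t y)).trans (hC y)

lemma measurable_greenRoot_mul (hu : Measurable u) :
    Measurable (fun p : ℝ × ℝ => (greenRoot k p.1 p.2 : ℂ) * u p.2) :=
  (Complex.measurable_ofReal.comp (measurable_greenRoot k)).mul (hu.comp measurable_snd)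

lemma integrable_greenRoot_mul (hu : Measurable u) (hC : ∀ y, ‖u y‖ ≤ C) (t : ℝ) :
    Integrable (fun y => (greenRoot k t y : ℂ) * u y) sectionMeasure :=
  .of_bound ((measurable_greenRoot_mul hu).comp measurable_prodMk_left).aestronglyMeasurable C
    (.of_forall (norm_greenRoot_mul_le hC t))

lemma stronglyMeasurable_greenTransform (hu : Measurable u) :
    StronglyMeasurable (greenTransform k u) :=
  (measurable_greenRoot_mul hu).stronglyMeasurable.integral_prod_right

lemma norm_greenTransform_le (hC : ∀ y, ‖u y‖ ≤ C) (t : ℝ) : ‖greenTransform k u t‖ ≤ C := by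
  simpa [greenTransform] using norm_integral_le_of_norm_le_const (μ := sectionMeasure)
    (.of_forall (norm_greenRoot_mul_le (k := k) hC t))

lemma integrable_norm_sq_greenTransform (hu : Measurable u) (hC : ∀ y, ‖u y‖ ≤ C) :
    Integrable (fun t => ‖greenTransform k u t‖ ^ 2) sectionMeasure := by
  refine .of_bound (C := C ^ 2) ?_ (.of_forall fun t => ?_)
  · exact ((stronglyMeasurable_greenTransform hu).norm.pow 2).aestronglyMeasurable
  · rw [norm_pow, norm_norm]
    exact pow_le_pow_left₀ (norm_nonneg _) (norm_greenTransform_le hC t) 2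

lemma greenTransform_add (hu : Measurable u) (hC : ∀ y, ‖u y‖ ≤ C)
    (hv : Measurable v) (hD : ∀ y, ‖v y‖ ≤ D) (t : ℝ) :
    greenTransform k (fun y => u y + v y) t = greenTransform k u t + greenTransform k v t := by
  unfold greenTransform
  rw [← integral_add (integrable_greenRoot_mul hu hC t) (integrable_greenRoot_mul hv hD t)]
  simp only [mul_add]

lemma greenForm_add_ge (hu : Measurable u) (hC : ∀ y, ‖u y‖ ≤ C)
    (hv : Measurable v) (hD : ∀ y, ‖v y‖ ≤ D) :
    greenForm k v / 2 - greenForm k u ≤ greenForm k (fun y => u y + v y) := by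
  have huv : Measurable fun y => u y + v y := hu.add hv
  have hCD : ∀ y, ‖u y + v y‖ ≤ C + D := fun y => norm_add_le_of_le (hC y) (hD y)
  have iu := integrable_norm_sq_greenTransform (k := k) hu hC
  have iv := integrable_norm_sq_greenTransform (k := k) hv hD
  unfold greenForm
  rw [← integral_div, ← integral_sub (iv.div_const 2) iu]
  refine integral_mono ((iv.div_const 2).sub iu) (integrable_norm_sq_greenTransform huv hCD)
    fun t => ?_
  simp only [greenTransform_add hu hC hv hD]
  have h : ‖greenTransform k v t‖ ≤
      ‖greenTransform k u t + greenTransform k v t‖ + ‖greenTransform k u t‖ := by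
    simpa using norm_sub_le (greenTransform k u t + greenTransform k v t) (greenTransform k u t)
  nlinarith [norm_nonneg (greenTransform k v t),
    sq_nonneg (‖greenTransform k u t + greenTransform k v t‖ - ‖greenTransform k u t‖)]

/-- The energy of the `k`-th mode is a square. -/
lemma integral_green_eq_neg_greenForm (hu : Measurable u) (hC : ∀ y, ‖u y‖ ≤ C) :
    ∫ y in (0:ℝ)..1, ∫ z in (0:ℝ)..1,
      (green k y z : ℂ) * u y * (starRingEnd ℂ) (u z) = ((-greenForm k u : ℝ) : ℂ) := by
  have hC0 : 0 ≤ C := (norm_nonneg _).trans (hC 0)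
  have hmem : ∀ᵐ y ∂sectionMeasure, y ∈ Set.Ioo (0:ℝ) 1 := ae_restrict_mem measurableSet_Ioo
  have hT := stronglyMeasurable_greenTransform (k := k) hu
  have hm := measurable_greenRoot_mul (k := k) hu
  have hconj : Measurable (starRingEnd ℂ) := Complex.continuous_conj.measurable
  have inner : ∀ᵐ y ∂sectionMeasure, ∫ z in (0:ℝ)..1,
      (green k y z : ℂ) * u y * (starRingEnd ℂ) (u z) =
      -∫ t, (greenRoot k t y : ℂ) * u y * (starRingEnd ℂ) (greenTransform k u t)
        ∂sectionMeasure := by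
    filter_upwards [hmem] with y hy
    rw [intervalIntegral_eq_section]
    have step : ∀ᵐ z ∂sectionMeasure, (green k y z : ℂ) * u y * (starRingEnd ℂ) (u z) =
        -∫ t, (greenRoot k t y : ℂ) * u y * (starRingEnd ℂ) ((greenRoot k t z : ℂ) * u z)
          ∂sectionMeasure := by
      filter_upwards [hmem] with z hz
      rw [green_eq_neg_integral k hy hz, Complex.ofReal_neg, ← integral_complex_ofReal,
        neg_mul, neg_mul, ← integral_mul_const, ← integral_mul_const]
      congr 1
      refine integral_congr_ae (.of_forall fun t => ?_)
      simp only [map_mul, Complex.conj_ofReal]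
      push_cast
      ring
    rw [integral_congr_ae step, integral_neg, integral_integral_swap]
    · congr 1
      refine integral_congr_ae (.of_forall fun t => ?_)
      simp only [greenTransform]
      rw [integral_const_mul, integral_conj]
    · refine .of_bound (C := C * C) ?_ (.of_forall fun p => ?_)
      · refine Measurable.aestronglyMeasurable ?_
        exact (hm.comp (measurable_snd.prodMk measurable_const)).mul
          (hconj.comp (hm.comp (measurable_snd.prodMk measurable_fst)))
      · simp only [Function.uncurry]
        rw [norm_mul, RCLike.norm_conj]
        exact mul_le_mul (norm_greenRoot_mul_le hC _ _) (norm_greenRoot_mul_le hC _ _)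
          (norm_nonneg _) hC0
  rw [intervalIntegral_eq_section, integral_congr_ae inner, integral_neg, integral_integral_swap]
  · rw [Complex.ofReal_neg, greenForm, ← integral_complex_ofReal]
    congr 1
    refine integral_congr_ae (.of_forall fun t => ?_)
    simp only
    rw [integral_mul_const, ← greenTransform, Complex.mul_conj, Complex.normSq_eq_norm_sq]
  · refine .of_bound (C := C * C) ?_ (.of_forall fun p => ?_)
    · refine Measurable.aestronglyMeasurable ?_
      exact (hm.comp measurable_swap).mul
        (hconj.comp (hT.measurable.comp measurable_snd))
    · simp only [Function.uncurry]
      rw [norm_mul, RCLike.norm_conj]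
      exact mul_le_mul (norm_greenRoot_mul_le hC _ _) (norm_greenTransform_le hC _)
        (norm_nonneg _) hC0

lemma integral_greenRoot_le (hk : k ≠ 0) {t : ℝ} (ht : t ∈ Set.Ioo (0:ℝ) 1) :
    ∫ y, greenRoot k t y ∂sectionMeasure ≤ 1 / |(k : ℝ)| := by
  have hk' : 0 < |(k : ℝ)| := abs_pos.2 (by exact_mod_cast hk)
  have hd : ∀ y ∈ Set.uIcc t 1, HasDerivAt
      (fun y => -Real.exp (-(|(k : ℝ)| * (y - t))) / |(k : ℝ)|)
      (Real.exp (-(|(k : ℝ)| * (y - t)))) y := by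
    intro y _
    have h1 : HasDerivAt (fun y => -(|(k : ℝ)| * (y - t))) (-|(k : ℝ)|) y := by
      exact (((hasDerivAt_id y).sub_const t).const_mul |(k : ℝ)|).neg.congr_deriv (by simp)
    refine ((h1.exp.neg).div_const |(k : ℝ)|).congr_deriv ?_
    field_simp
  have hI := intervalIntegral.integral_eq_sub_of_hasDerivAt hd
    (Continuous.intervalIntegrable (by fun_prop) _ _)
  have hsub : Set.Ico t 1 ⊆ Set.Ioo (0:ℝ) 1 := fun y hy => ⟨ht.1.trans_le hy.1, hy.2⟩
  have hle : ∫ y, greenRoot k t y ∂sectionMeasure ≤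
      ∫ y in t..1, Real.exp (-(|(k : ℝ)| * (y - t))) := by
    rw [sectionMeasure, setIntegral_eq_of_subset_of_forall_sdiff_eq_zero measurableSet_Ioo hsub,
      intervalIntegral.integral_of_le ht.2.le, integral_Ioc_eq_integral_Ioo,
      ← integral_Ico_eq_integral_Ioo]
    · refine setIntegral_mono_on ?_ ?_ measurableSet_Ico fun y hy => greenRoot_le_exp k hy.1
      · exact integrable_greenRoot k t _
      · exact (Continuous.integrableOn_Icc (by fun_prop)).mono_set Set.Ico_subset_Icc_self
    · intro y hy
      refine greenRoot_of_lt k ?_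
      by_contra h
      exact hy.2 ⟨not_lt.1 h, hy.1.2⟩
  refine hle.trans (hI.trans_le ?_)
  have : 0 < Real.exp (-(|(k : ℝ)| * (1 - t))) / |(k : ℝ)| := by positivity
  simp only [sub_self, mul_zero, neg_zero, Real.exp_zero, neg_div]
  linarith

lemma greenForm_le (hC : ∀ y, ‖u y‖ ≤ C) (hk : k ≠ 0) :
    greenForm k u ≤ C ^ 2 * (1 / (k : ℝ) ^ 2) := by
  have hC0 : 0 ≤ C := (norm_nonneg _).trans (hC 0)
  have hb : ∀ᵐ t ∂sectionMeasure, ‖(‖greenTransform k u t‖ ^ 2)‖ ≤ C ^ 2 * (1 / (k : ℝ) ^ 2) := by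
    filter_upwards [ae_restrict_mem measurableSet_Ioo] with t ht
    have h1 : ‖greenTransform k u t‖ ≤ ∫ y, greenRoot k t y * C ∂sectionMeasure := by
      refine norm_integral_le_of_norm_le ?_ (.of_forall fun y => ?_)
      · exact (integrable_greenRoot k t _).mul_const C
      · rw [norm_mul, Complex.norm_real, Real.norm_of_nonneg (greenRoot_nonneg k t y)]
        exact mul_le_mul_of_nonneg_left (hC y) (greenRoot_nonneg k t y)
    rw [integral_mul_const] at h1
    have h2 := h1.trans (mul_le_mul_of_nonneg_right (integral_greenRoot_le hk ht) hC0)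
    rw [norm_pow, norm_norm]
    refine (pow_le_pow_left₀ (norm_nonneg _) h2 2).trans_eq ?_
    rw [mul_pow, div_pow, sq_abs]; ring
  simpa [greenForm] using (le_abs_self _).trans (norm_integral_le_of_norm_le_const hb)

end Bounded

section Fourier

variable {ω η : ℝ × ℝ → ℝ} {C D : ℝ}

lemma norm_exp_neg_I_mul (k : ℤ) (x : ℝ) : ‖Complex.exp (-(Complex.I * k * x))‖ = 1 := by
  rw [Complex.norm_exp]
  simp

lemma measurable_fourierCoef (hω : Measurable ω) (k : ℤ) : Measurable (fourierCoef ω k) := by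
  unfold fourierCoef
  simp only [intervalIntegral.integral_of_le Real.two_pi_pos.le]
  refine Measurable.const_mul (StronglyMeasurable.measurable ?_) _
  refine StronglyMeasurable.integral_prod_left
    (f := fun (x₁ y : ℝ) => Complex.exp (-(Complex.I * k * x₁)) * (ω (x₁, y) : ℂ))
    (Measurable.stronglyMeasurable ?_)
  fun_prop

lemma norm_fourierCoef_le (hC : ∀ p, |ω p| ≤ C) (k : ℤ) (y : ℝ) : ‖fourierCoef ω k y‖ ≤ C := by
  have h := intervalIntegral.norm_integral_le_of_norm_le_const (a := 0) (b := 2 * Real.pi)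
    (f := fun x₁ : ℝ => Complex.exp (-(Complex.I * k * x₁)) * (ω (x₁, y) : ℂ)) (C := C)
    fun x _ => by
      rw [norm_mul, norm_exp_neg_I_mul, one_mul, Complex.norm_real]
      exact hC _
  have hpi := Real.two_pi_pos
  rw [sub_zero, abs_of_pos hpi] at h
  have hn : ‖(1 / (2 * Real.pi) : ℂ)‖ = 1 / (2 * Real.pi) := by
    rw [← Complex.ofReal_ofNat, ← Complex.ofReal_mul, ← Complex.ofReal_one,
      ← Complex.ofReal_div, Complex.norm_real, Real.norm_of_nonneg (by positivity)]
  rw [fourierCoef, norm_mul, hn]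
  refine (mul_le_mul_of_nonneg_left h (by positivity)).trans_eq ?_
  field_simp

lemma intervalIntegrable_exp_mul (hω : Measurable ω) (hC : ∀ p, |ω p| ≤ C) (k : ℤ) (y : ℝ) :
    IntervalIntegrable (fun x₁ : ℝ => Complex.exp (-(Complex.I * k * x₁)) * (ω (x₁, y) : ℂ))
      volume 0 (2 * Real.pi) := by
  rw [intervalIntegrable_iff_integrableOn_Ioc_of_le Real.two_pi_pos.le]
  refine Measure.integrableOn_of_bounded (M := C) measure_Ioc_lt_top.ne (Measurable.aestronglyMeasurable ?_)
    (.of_forall fun x => ?_)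
  · fun_prop
  · rw [norm_mul, norm_exp_neg_I_mul, one_mul, Complex.norm_real]
    exact hC _

lemma fourierCoef_add (hω : Measurable ω) (hC : ∀ p, |ω p| ≤ C)
    (hη : Measurable η) (hD : ∀ p, |η p| ≤ D) (k : ℤ) :
    fourierCoef (fun p => ω p + η p) k = fun y => fourierCoef ω k y + fourierCoef η k y := by
  funext y
  unfold fourierCoef
  rw [← mul_add, ← intervalIntegral.integral_add (intervalIntegrable_exp_mul hω hC k y)
    (intervalIntegrable_exp_mul hη hD k y)]
  congr 2
  funext x
  push_cast
  ring

lemma energy_eq_tsum_greenForm (hω : Measurable ω) (hC : ∀ p, |ω p| ≤ C) :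
    energy ω = Real.pi * ∑' k : ℤ, greenForm k (fourierCoef ω k) := by
  unfold energy
  simp only [integral_green_eq_neg_greenForm (measurable_fourierCoef hω _)
    (norm_fourierCoef_le hC _), Complex.ofReal_re, tsum_neg]
  ring

lemma summable_greenForm_fourierCoef (hC : ∀ p, |ω p| ≤ C) :
    Summable fun k : ℤ => greenForm k (fourierCoef ω k) := by
  refine Summable.of_norm_bounded_eventually (g := fun k : ℤ => C ^ 2 * (1 / (k : ℝ) ^ 2))
    ((Real.summable_one_div_int_pow.2 one_lt_two).mul_left _) ?_
  filter_upwards [(Set.finite_singleton (0 : ℤ)).compl_mem_cofinite] with k hk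
  rw [Real.norm_of_nonneg (greenForm_nonneg _ _)]
  exact greenForm_le (norm_fourierCoef_le hC k) hk

lemma energy_congr_ae (h : ω =ᵐ[μM] η) : energy ω = energy η := by
  have h1 : ∀ᵐ y ∂(volume.restrict (Set.Icc (0:ℝ) 1)),
      ∀ᵐ x ∂(volume.restrict (Set.Ioc 0 (2 * Real.pi))), ω (x, y) = η (x, y) := by
    have : ∀ᵐ p ∂((volume.restrict (Set.Icc (0:ℝ) 1)).prod
        (volume.restrict (Set.Ioc 0 (2 * Real.pi)))), ω p.swap = η p.swap := by
      have h' := h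
      rw [μM, channel, Measure.volume_eq_prod, ← Measure.prod_restrict, ← Measure.prod_swap] at h'
      exact ae_of_ae_map measurable_swap.aemeasurable h'
    exact Measure.ae_ae_of_ae_prod this
  have h2 : ∀ᵐ y ∂sectionMeasure, ∀ k, fourierCoef ω k y = fourierCoef η k y := by
    filter_upwards [ae_restrict_of_ae_restrict_of_subset Set.Ioo_subset_Icc_self h1] with y hy k
    unfold fourierCoef
    rw [intervalIntegral.integral_of_le Real.two_pi_pos.le,
      intervalIntegral.integral_of_le Real.two_pi_pos.le]
    congr 1
    refine integral_congr_ae ?_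
    filter_upwards [hy] with x hx
    rw [hx]
  unfold energy
  congr 2
  funext k
  congr 1
  rw [intervalIntegral_eq_section, intervalIntegral_eq_section]
  refine integral_congr_ae ?_
  filter_upwards [h2] with y hy
  rw [intervalIntegral_eq_section, intervalIntegral_eq_section]
  refine integral_congr_ae ?_
  filter_upwards [h2] with z hz
  rw [hy, hz]

end Fourier

section Bump

/-- The vortex perturbation `δ ε⁻² 𝟙_{[π-ε,π+ε]}(x₁) 𝟙_{[1/2-ε,1/2+ε]}(x₂)`. -/
def bump (δ ε : ℝ) (x : ℝ × ℝ) : ℝ :=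
  δ / ε ^ 2 * (Set.Icc (Real.pi - ε) (Real.pi + ε)).indicator (fun _ => (1:ℝ)) x.1 *
    (Set.Icc (1 / 2 - ε) (1 / 2 + ε)).indicator (fun _ => (1:ℝ)) x.2

lemma measurable_bump (δ ε : ℝ) : Measurable (bump δ ε) := by
  have h1 : Measurable ((Set.Icc (Real.pi - ε) (Real.pi + ε)).indicator (fun _ => (1:ℝ))) :=
    measurable_const.indicator measurableSet_Icc
  have h2 : Measurable ((Set.Icc (1 / 2 - ε) (1 / 2 + ε)).indicator (fun _ => (1:ℝ))) :=
    measurable_const.indicator measurableSet_Icc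
  unfold bump
  fun_prop

lemma bump_eq_indicator (δ ε : ℝ) : bump δ ε =
    (Set.Icc (Real.pi - ε) (Real.pi + ε) ×ˢ Set.Icc (1 / 2 - ε) (1 / 2 + ε)).indicator
      (fun _ => δ / ε ^ 2) := by
  funext x
  by_cases h1 : x.1 ∈ Set.Icc (Real.pi - ε) (Real.pi + ε) <;>
  by_cases h2 : x.2 ∈ Set.Icc (1 / 2 - ε) (1 / 2 + ε) <;>
  simp only [bump, Set.indicator, Set.mem_prod, h1, h2] <;> simp

lemma abs_bump_le {δ : ℝ} (hδ : 0 < δ) (ε : ℝ) (x : ℝ × ℝ) : |bump δ ε x| ≤ δ / ε ^ 2 := by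
  have : 0 ≤ δ / ε ^ 2 := by positivity
  rw [bump_eq_indicator, Set.indicator_apply]
  split_ifs <;> simp [abs_of_nonneg, this]

lemma integral_abs_bump {δ ε : ℝ} (hδ : 0 < δ) (hε : 0 < ε) (hε' : ε ≤ 1 / 4) :
    ∫ x, |bump δ ε x| ∂μM = 4 * δ := by
  have hpi := Real.pi_gt_three
  have hsub : Set.Icc (Real.pi - ε) (Real.pi + ε) ×ˢ Set.Icc (1 / 2 - ε) (1 / 2 + ε) ⊆
      channel :=
    Set.prod_mono (fun x hx => ⟨by linarith [hx.1], by linarith [hx.2]⟩)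
      (fun x hx => ⟨by linarith [hx.1], by linarith [hx.2]⟩)
  have hm : MeasurableSet
      (Set.Icc (Real.pi - ε) (Real.pi + ε) ×ˢ Set.Icc (1 / 2 - ε) (1 / 2 + ε)) :=
    measurableSet_Icc.prod measurableSet_Icc
  have habs : ∀ x, |bump δ ε x| = bump δ ε x := fun x => abs_of_nonneg <| by
    rw [bump_eq_indicator]
    exact Set.indicator_nonneg (fun _ _ => by positivity) x
  simp only [habs]
  rw [bump_eq_indicator, integral_indicator hm, μM, Measure.restrict_restrict hm,
    Set.inter_eq_left.2 hsub, setIntegral_const, measureReal_def, Measure.volume_eq_prod,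
    Measure.prod_prod, Real.volume_Icc, Real.volume_Icc, ENNReal.toReal_mul,
    ENNReal.toReal_ofReal (by linarith), ENNReal.toReal_ofReal (by linarith), smul_eq_mul]
  field_simp
  ring

lemma norm_integral_exp_ge (k : ℤ) {ε : ℝ} (hε : 0 < ε) (hk : |(k : ℝ)| * ε ≤ 1) :
    ε ≤ ‖∫ x in (Real.pi - ε)..(Real.pi + ε), Complex.exp (-(Complex.I * k * x))‖ := by
  have hrot : ‖Complex.exp (Complex.I * k * Real.pi)‖ = 1 := by
    rw [Complex.norm_exp]; simp
  have hcos : ε ≤ ∫ x in (Real.pi - ε)..(Real.pi + ε), Real.cos (k * (x - Real.pi)) := by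
    have h : ∫ _ in (Real.pi - ε)..(Real.pi + ε), (1 / 2 : ℝ) ≤
        ∫ x in (Real.pi - ε)..(Real.pi + ε), Real.cos (k * (x - Real.pi)) := by
      refine intervalIntegral.integral_mono_on (by linarith) (by simp)
        (Continuous.intervalIntegrable (by fun_prop) _ _) fun x hx => ?_
      refine le_trans ?_ (Real.one_sub_sq_div_two_le_cos)
      have h1 : |x - Real.pi| ≤ ε := abs_le.2 ⟨by linarith [hx.1], by linarith [hx.2]⟩
      have h2 : |(k : ℝ) * (x - Real.pi)| ≤ 1 := by
        rw [abs_mul]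
        exact (mul_le_mul_of_nonneg_left h1 (abs_nonneg _)).trans hk
      have := (sq_le_one_iff_abs_le_one _).2 h2
      linarith
    rw [intervalIntegral.integral_const, smul_eq_mul] at h
    linarith
  have hre : (Complex.exp (Complex.I * k * Real.pi) *
      ∫ x in (Real.pi - ε)..(Real.pi + ε), Complex.exp (-(Complex.I * k * x))).re =
      ∫ x in (Real.pi - ε)..(Real.pi + ε), Real.cos (k * (x - Real.pi)) := by
    rw [← intervalIntegral.integral_const_mul, ← Complex.reCLM_apply,
      ← ContinuousLinearMap.intervalIntegral_comp_comm _
        (Continuous.intervalIntegrable (by fun_prop) _ _)]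
    refine intervalIntegral.integral_congr fun x _ => ?_
    simp only [Complex.reCLM_apply]
    rw [← Complex.exp_add, Complex.exp_re]
    simp only [Complex.add_re, Complex.neg_re, Complex.mul_re, Complex.I_re, Complex.I_im,
      Complex.intCast_re, Complex.intCast_im, Complex.ofReal_re, Complex.ofReal_im,
      Complex.add_im, Complex.neg_im, Complex.mul_im]
    rw [← Real.cos_neg (k * (x - Real.pi))]
    ring_nf
    simp
  calc ε ≤ _ := hcos
    _ = _ := hre.symm
    _ ≤ _ := (Complex.re_le_norm _)
    _ = _ := by rw [norm_mul, hrot, one_mul]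

lemma fourierCoef_bump (δ : ℝ) {ε : ℝ} (hε : 0 < ε) (hε' : ε ≤ 1 / 4) (k : ℤ) (y : ℝ) :
    fourierCoef (bump δ ε) k y = ((δ / (2 * Real.pi * ε ^ 2) : ℝ) : ℂ) *
      (∫ x in (Real.pi - ε)..(Real.pi + ε), Complex.exp (-(Complex.I * k * x))) *
      (((Set.Icc (1 / 2 - ε) (1 / 2 + ε)).indicator (fun _ => (1:ℝ)) y : ℝ) : ℂ) := by
  have hpi := Real.pi_gt_three
  have hsub : Set.Icc (Real.pi - ε) (Real.pi + ε) ⊆ Set.Ioc 0 (2 * Real.pi) :=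
    fun x hx => ⟨by linarith [hx.1], by linarith [hx.2]⟩
  have h : ∀ x : ℝ, Complex.exp (-(Complex.I * k * x)) * (bump δ ε (x, y) : ℂ) =
      (((δ / ε ^ 2 : ℝ) : ℂ) *
        (((Set.Icc (1 / 2 - ε) (1 / 2 + ε)).indicator (fun _ => (1:ℝ)) y : ℝ) : ℂ)) *
      (Set.Icc (Real.pi - ε) (Real.pi + ε)).indicator
        (fun x : ℝ => Complex.exp (-(Complex.I * k * x))) x := by
    intro x
    by_cases hx : x ∈ Set.Icc (Real.pi - ε) (Real.pi + ε)
    · simp only [bump, Set.indicator_of_mem hx]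
      push_cast
      ring
    · simp only [bump, Set.indicator_of_notMem hx]
      simp
  unfold fourierCoef
  simp only [h]
  rw [intervalIntegral.integral_const_mul, intervalIntegral.integral_of_le Real.two_pi_pos.le,
    integral_indicator measurableSet_Icc, Measure.restrict_restrict measurableSet_Icc,
    Set.inter_eq_left.2 hsub, integral_Icc_eq_integral_Ioc,
    ← intervalIntegral.integral_of_le (by linarith)]
  push_cast
  field_simp

lemma greenRoot_ge {k : ℤ} (hk : 1 ≤ k) {t y : ℝ} (hty : t ≤ y) (hy : y ≤ 3 / 4)
    (hkty : k * (y - t) ≤ 3) : Real.exp (-3) / 3 ≤ greenRoot k t y := by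
  have hk' : (1 : ℝ) ≤ k := by exact_mod_cast hk
  have hk0 : k ≠ 0 := by omega
  simp only [greenRoot, profile, hk0, if_false, hty, show y ≤ 1 by linarith, and_self, if_true]
  have hb : 1 / 4 ≤ (k : ℝ) * (1 - y) := by nlinarith
  have ha : 0 < (k : ℝ) * (1 - t) := by nlinarith
  have hsb : Real.exp (k * (1 - y)) / 6 ≤ Real.sinh (k * (1 - y)) := by
    rw [Real.sinh_eq]
    have h1 : Real.exp (-(k * (1 - y))) ≤ Real.exp (k * (1 - y)) * (2 / 3) := by
      have h2 : 3 / 2 ≤ Real.exp (2 * (k * (1 - y))) := by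
        linarith [Real.add_one_le_exp (2 * (k * (1 - y)))]
      have h3 : Real.exp (-(k * (1 - y))) * Real.exp (2 * (k * (1 - y))) =
          Real.exp (k * (1 - y)) := by
        rw [← Real.exp_add]; ring_nf
      nlinarith [Real.exp_pos (-(k * (1 - y)))]
    linarith
  have hsa : Real.sinh (k * (1 - t)) ≤ Real.exp (k * (1 - t)) / 2 := by
    rw [Real.sinh_eq]
    linarith [Real.exp_pos (-(k * (1 - t)))]
  have hexp : Real.exp (-3) * Real.exp (k * (1 - t)) ≤ Real.exp (k * (1 - y)) := by
    rw [← Real.exp_add]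
    exact Real.exp_le_exp.2 (by linarith)
  rw [le_div_iff₀ (Real.sinh_pos_iff.2 ha)]
  nlinarith [Real.exp_pos (-3)]

/-- The energy of the vortex in the mode `k` is at least of order `1 / k`, as long as
`k ε ≤ 1`. -/
lemma greenForm_bump_ge {δ ε : ℝ} (hδ : 0 < δ) (hε : 0 < ε) (hε' : ε ≤ 1 / 4) {k : ℤ}
    (hk : 1 ≤ k) (hkε : k * ε ≤ 1) :
    (δ * Real.exp (-3) / (3 * Real.pi)) ^ 2 / 4 * (1 / (k : ℝ)) ≤
      greenForm k (fourierCoef (bump δ ε) k) := by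
  have hk' : (1 : ℝ) ≤ k := by exact_mod_cast hk
  have hkinv : 1 / (4 * (k : ℝ)) ≤ 1 / 4 := by
    rw [div_le_div_iff₀ (by positivity) (by positivity)]; linarith
  have hkinv0 : 0 < 1 / (4 * (k : ℝ)) := by positivity
  have hpi := Real.pi_pos
  set J := Set.Icc (1 / 2 - ε) (1 / 2 + ε) with hJ
  set I := Set.Ioo (1 / 2 - ε - 1 / (4 * (k : ℝ))) (1 / 2 - ε) with hI
  set c : ℂ := ((δ / (2 * Real.pi * ε ^ 2) : ℝ) : ℂ) *
      (∫ x in (Real.pi - ε)..(Real.pi + ε), Complex.exp (-(Complex.I * k * x))) with hc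
  have hJsub : J ⊆ Set.Ioo (0:ℝ) 1 := fun y hy => ⟨by linarith [hy.1], by linarith [hy.2]⟩
  have hIsub : I ⊆ Set.Ioo (0:ℝ) 1 := fun y hy => ⟨by linarith [hy.1], by linarith [hy.2]⟩
  have hcnorm : δ / (2 * Real.pi * ε) ≤ ‖c‖ := by
    have := norm_integral_exp_ge k hε (by rwa [abs_of_pos (by linarith)])
    rw [hc, norm_mul, Complex.norm_real, Real.norm_of_nonneg (by positivity)]
    refine le_trans (le_of_eq ?_) (mul_le_mul_of_nonneg_left this (by positivity))
    field_simp
  have hT : ∀ t ∈ I, δ * Real.exp (-3) / (3 * Real.pi) ≤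
      ‖greenTransform k (fourierCoef (bump δ ε) k) t‖ := by
    intro t ht
    have heq : greenTransform k (fourierCoef (bump δ ε) k) t =
        c * ((∫ y in J, greenRoot k t y : ℝ) : ℂ) := by
      have h1 : ∫ y in J, greenRoot k t y =
          ∫ y, greenRoot k t y * J.indicator (fun _ => (1:ℝ)) y ∂sectionMeasure := by
        have h2 : (fun y => greenRoot k t y * J.indicator (fun _ => (1:ℝ)) y) =
            J.indicator (greenRoot k t) := by
          funext y
          by_cases hy : y ∈ J <;> simp [hy]
        rw [h2, integral_indicator measurableSet_Icc, sectionMeasure,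
          Measure.restrict_restrict measurableSet_Icc, Set.inter_eq_left.2 hJsub]
      rw [h1, ← integral_complex_ofReal, ← integral_const_mul]
      refine integral_congr_ae (.of_forall fun y => ?_)
      simp only [fourierCoef_bump δ hε hε' k y, ← hJ, ← hc, Complex.ofReal_mul]
      ring
    have hmass : 2 * ε * (Real.exp (-3) / 3) ≤ ∫ y in J, greenRoot k t y := by
      have h1 : ∫ _ in J, Real.exp (-3) / 3 ≤ ∫ y in J, greenRoot k t y := by
        have : IsFiniteMeasure (volume.restrict J) := ⟨by simp [hJ]⟩
        refine setIntegral_mono_on (integrable_const _) (integrable_greenRoot k t _)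
          measurableSet_Icc fun y hy => ?_
        refine greenRoot_ge hk (by linarith [ht.2, hy.1]) (by linarith [hy.2]) ?_
        have h3 : y - t ≤ 2 * ε + 1 / (4 * (k : ℝ)) := by linarith [ht.1, hy.2]
        have h4 : (k : ℝ) * (1 / (4 * (k : ℝ))) = 1 / 4 := by field_simp
        nlinarith
      rw [setIntegral_const, measureReal_def, Real.volume_Icc,
        ENNReal.toReal_ofReal (by linarith), smul_eq_mul] at h1
      linarith
    rw [heq, norm_mul, Complex.norm_real]
    refine le_trans (le_of_eq ?_)
      (mul_le_mul hcnorm (hmass.trans (le_abs_self _)) (by positivity) (norm_nonneg _))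
    field_simp
  have hmeas := measurable_fourierCoef (measurable_bump δ ε) k
  have hbd := norm_fourierCoef_le (abs_bump_le hδ ε) k
  have hsqint := integrable_norm_sq_greenTransform (k := k) hmeas hbd
  calc (δ * Real.exp (-3) / (3 * Real.pi)) ^ 2 / 4 * (1 / (k : ℝ))
      = ∫ _ in I, (δ * Real.exp (-3) / (3 * Real.pi)) ^ 2 := by
        rw [setIntegral_const, measureReal_def, Real.volume_Ioo,
          ENNReal.toReal_ofReal (by linarith), smul_eq_mul]
        field_simp
        ring
    _ ≤ ∫ t in I, ‖greenTransform k (fourierCoef (bump δ ε) k) t‖ ^ 2 := by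
        refine setIntegral_mono_on ?_ ?_ measurableSet_Ioo fun t ht =>
          pow_le_pow_left₀ (by positivity) (hT t ht) 2
        · exact integrableOn_const (by simp [hI])
        · exact IntegrableOn.mono_set hsqint hIsub
    _ ≤ greenForm k (fourierCoef (bump δ ε) k) :=
        setIntegral_mono_set hsqint (.of_forall fun _ => by positivity)
          (LE.le.eventuallyLE hIsub)

end Bump

lemma pertVort_eq_add_bump (ω : ℝ × ℝ → ℝ) (δ ε : ℝ) :
    pertVort ω δ ε = fun p => ω p + bump δ ε p := rfl

/-- Lower bound for the energy of the perturbed vorticity through the modes `1, …, N`. -/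
lemma energy_pertVort_ge {ω : ℝ × ℝ → ℝ} {C δ ε : ℝ} (hω : Measurable ω) (hC : ∀ p, |ω p| ≤ C)
    (hδ : 0 < δ) (hε : 0 < ε) (hε' : ε ≤ 1 / 4) {N : ℕ} (hN : N * ε ≤ 1) :
    Real.pi * ((δ * Real.exp (-3) / (3 * Real.pi)) ^ 2 / 8 *
        ∑ i ∈ Finset.range N, 1 / ((i : ℝ) + 1) - C ^ 2 * ∑' k : ℤ, 1 / (k : ℝ) ^ 2) ≤
      energy (pertVort ω δ ε) := by
  have hb := measurable_bump δ ε
  have hbC := abs_bump_le hδ ε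
  have hsumC : ∀ p, |ω p + bump δ ε p| ≤ C + δ / ε ^ 2 := fun p =>
    (abs_add_le _ _).trans (add_le_add (hC p) (hbC p))
  have hsum : Measurable fun p => ω p + bump δ ε p := hω.add hb
  rw [pertVort_eq_add_bump, energy_eq_tsum_greenForm hsum hsumC]
  refine mul_le_mul_of_nonneg_left ?_ Real.pi_pos.le
  let e : ℕ ↪ ℤ := ⟨fun i => (i : ℤ) + 1, fun i j h => by simpa using h⟩
  have hedef : ∀ i, e i = (i : ℤ) + 1 := fun _ => rfl
  have hmode : ∀ i ∈ Finset.range N,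
      (δ * Real.exp (-3) / (3 * Real.pi)) ^ 2 / 8 * (1 / ((i : ℝ) + 1)) -
        C ^ 2 * (1 / ((e i : ℤ) : ℝ) ^ 2) ≤
      greenForm (e i) (fourierCoef (fun p => ω p + bump δ ε p) (e i)) := by
    intro i hi
    have hi' : (i : ℝ) + 1 ≤ N := by exact_mod_cast Finset.mem_range.1 hi
    have hei : ((e i : ℤ) : ℝ) = (i : ℝ) + 1 := by simp [hedef]
    have he1 : 1 ≤ e i := by simp [hedef]
    have h1 := greenForm_bump_ge hδ hε hε' he1
      (by rw [hei]; exact (mul_le_mul_of_nonneg_right hi' hε.le).trans hN)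
    have h2 := greenForm_le (norm_fourierCoef_le hC (e i)) (by omega : e i ≠ 0)
    have h3 := greenForm_add_ge (k := e i) (measurable_fourierCoef hω (e i))
      (norm_fourierCoef_le hC _) (measurable_fourierCoef hb (e i)) (norm_fourierCoef_le hbC _)
    rw [fourierCoef_add hω hC hb hbC]
    rw [hei] at h1
    linarith
  calc _ ≤ ∑ i ∈ Finset.range N, ((δ * Real.exp (-3) / (3 * Real.pi)) ^ 2 / 8 *
        (1 / ((i : ℝ) + 1)) - C ^ 2 * (1 / ((e i : ℤ) : ℝ) ^ 2)) := by
        rw [Finset.sum_sub_distrib, ← Finset.mul_sum, ← Finset.mul_sum]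
        refine sub_le_sub_left (mul_le_mul_of_nonneg_left ?_ (sq_nonneg C)) _
        rw [← Finset.sum_map (Finset.range N) e (fun k : ℤ => 1 / (k : ℝ) ^ 2)]
        exact (Real.summable_one_div_int_pow.2 one_lt_two).sum_le_tsum _
          fun _ _ => by positivity
    _ ≤ _ := Finset.sum_le_sum hmode
    _ ≤ _ := by
        rw [← Finset.sum_map (Finset.range N) e
          (fun k => greenForm k (fourierCoef (fun p => ω p + bump δ ε p) k))]
        exact (summable_greenForm_fourierCoef hsumC).sum_le_tsum _
          fun _ _ => greenForm_nonneg _ _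

section Shear

variable {W : ℝ → ℝ}

lemma fourierCoef_shear (W : ℝ → ℝ) (k : ℤ) (y : ℝ) :
    fourierCoef (fun x => W x.2) k y = if k = 0 then (W y : ℂ) else 0 := by
  have hpi : (Real.pi : ℂ) ≠ 0 := by exact_mod_cast Real.pi_ne_zero
  simp only [fourierCoef]
  rw [intervalIntegral.integral_mul_const]
  split_ifs with hk
  · simp only [hk, Int.cast_zero, mul_zero, zero_mul, neg_zero, Complex.exp_zero,
      intervalIntegral.integral_const, sub_zero, Complex.real_smul, mul_one]
    push_cast
    field_simp
  · have hc : -(Complex.I * k) ≠ 0 := by simp [hk]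
    have h := integral_exp_mul_complex (a := 0) (b := 2 * Real.pi) hc
    have he : Complex.exp (-(Complex.I * k) * ((2 * Real.pi : ℝ) : ℂ)) = 1 := by
      rw [Complex.exp_eq_one_iff]
      exact ⟨-k, by push_cast; ring⟩
    rw [he] at h
    simp only [Complex.ofReal_zero, mul_zero, Complex.exp_zero, sub_self, zero_div, neg_mul] at h
    rw [h]
    simp

lemma abs_green_zero_le_one {y z : ℝ} (hy : y ∈ Set.Ioo (0:ℝ) 1) (hz : z ∈ Set.Ioo (0:ℝ) 1) :
    |green 0 y z| ≤ 1 := by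
  have h1 : 0 < min y z := lt_min hy.1 hz.1
  have h2 : max y z < 1 := max_lt hy.2 hz.2
  have h3 : min y z < 1 := (min_le_left _ _).trans_lt hy.2
  have h4 : 0 < max y z := hy.1.trans_le (le_max_left _ _)
  simp only [green, if_true, abs_neg]
  rw [abs_of_nonneg (by nlinarith)]
  nlinarith

/-- The energy of a shear flow is controlled by its `L¹` norm. -/
lemma energy_shear_le (hW : Integrable W sectionMeasure) :
    energy (fun x => W x.2) ≤ Real.pi * (∫ y, |W y| ∂sectionMeasure) ^ 2 := by
  have hmem : ∀ᵐ y ∂sectionMeasure, y ∈ Set.Ioo (0:ℝ) 1 := ae_restrict_mem measurableSet_Ioo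
  have hWn : Integrable (fun y => |W y|) sectionMeasure := hW.abs
  unfold energy
  rw [tsum_eq_single 0 fun k hk => by simp [fourierCoef_shear, hk]]
  simp only [fourierCoef_shear, if_true, Complex.conj_ofReal]
  set Q := ∫ y in (0:ℝ)..1, ∫ z in (0:ℝ)..1, (green 0 y z : ℂ) * W y * W z with hQ
  have hnorm : ‖Q‖ ≤ (∫ y, |W y| ∂sectionMeasure) ^ 2 := by
    rw [hQ, intervalIntegral_eq_section, sq, ← integral_mul_const]
    refine norm_integral_le_of_norm_le (hWn.mul_const _) ?_
    filter_upwards [hmem] with y hy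
    rw [intervalIntegral_eq_section, ← integral_const_mul]
    refine norm_integral_le_of_norm_le (hWn.const_mul _) ?_
    filter_upwards [hmem] with z hz
    rw [norm_mul, norm_mul, Complex.norm_real, Complex.norm_real, Complex.norm_real, mul_assoc]
    exact mul_le_of_le_one_left (by positivity) (abs_green_zero_le_one hy hz)
  have := (abs_le.1 (Complex.abs_re_le_norm Q)).1
  nlinarith [Real.pi_pos]

lemma integral_channel_shear (f : ℝ → ℝ) :
    ∫ x, f x.2 ∂μM = 2 * Real.pi * ∫ y, f y ∂sectionMeasure := by
  rw [μM, channel, Measure.volume_eq_prod, ← Measure.prod_restrict, integral_fun_snd,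
    sectionMeasure, integral_Icc_eq_integral_Ioc, integral_Ioc_eq_integral_Ioo]
  simp [measureReal_def, Real.pi_nonneg]

end Shear

/-- A bistochastic kernel contracts the `L¹` norm. -/
lemma IsBistochastic.lintegral_enorm_kernApply_le {X : Type*} [MeasurableSpace X] {μ : Measure X}
    {κ : Kernel X X} (hκ : IsBistochastic μ κ) {f : X → ℝ} (hf : AEStronglyMeasurable f μ) :
    ∫⁻ x, ‖kernApply κ f x‖ₑ ∂μ ≤ ∫⁻ x, ‖f x‖ₑ ∂μ := by
  have hbind : μ.bind κ = μ := by
    ext s hs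
    rw [Measure.bind_apply hs κ.measurable.aemeasurable, hκ.2 s hs]
  calc ∫⁻ x, ‖kernApply κ f x‖ₑ ∂μ ≤ ∫⁻ x, ∫⁻ y, ‖f y‖ₑ ∂(κ x) ∂μ :=
        lintegral_mono fun x => enorm_integral_le_lintegral_enorm _
    _ = ∫⁻ y, ‖f y‖ₑ ∂(μ.bind κ) :=
        (Measure.lintegral_bind κ.measurable.aemeasurable (by rw [hbind]; exact hf.enorm)).symm
    _ = _ := by rw [hbind]

/-- Every essentially bounded function agrees a.e. with a bounded measurable one. -/
lemma exists_measurable_bounded_ae_eq {X : Type*} [MeasurableSpace X] {μ : Measure X}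
    {f : X → ℝ} (hf : MemLp f ⊤ μ) :
    ∃ (g : X → ℝ) (C : ℝ), Measurable g ∧ (∀ x, |g x| ≤ C) ∧ f =ᵐ[μ] g := by
  set C := lpNorm f ⊤ μ
  have hC0 : 0 ≤ C := lpNorm_nonneg
  have hg := hf.aestronglyMeasurable.stronglyMeasurable_mk.measurable
  refine ⟨fun x => max (-C) (min (hf.aestronglyMeasurable.mk f x) C), C,
    measurable_const.max (hg.min measurable_const), fun x => ?_, ?_⟩
  · exact abs_le.2 ⟨le_max_left _ _, max_le (by linarith) (min_le_right _ _)⟩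
  · filter_upwards [hf.aestronglyMeasurable.ae_eq_mk, ae_le_lpNorm_exponent_top hf] with x hx hb
    have hb' := abs_le.1 hb
    rw [← hx, min_eq_left hb'.2, max_eq_right hb'.1]

instance : IsFiniteMeasure μM := by
  refine ⟨?_⟩
  rw [μM, Measure.restrict_apply_univ, channel, Measure.volume_eq_prod, Measure.prod_prod]
  exact ENNReal.mul_lt_top measure_Ioc_lt_top measure_Icc_lt_top

/-- a sufficiently concentrated vortex perturbation `ξ` of any
background `ω_b` is `L¹`-close to `ω_b` but no shear flow lies in
`closure(O_ξ)* ∩ {E = E(ξ)} ∩ {𝖬 = 𝖬(ξ)}`. -/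
theorem no_shear_in_orbit_closure
    (ωb : ℝ × ℝ → ℝ) (hωb : MemLp ωb ⊤ μM) (δ : ℝ) (hδ : 0 < δ) :
    ∃ ε₀ : ℝ, 0 < ε₀ ∧ ∀ ε : ℝ, 0 < ε → ε < ε₀ →
      ((∫ x, |pertVort ωb δ ε x - ωb x| ∂μM) = 4 * δ) ∧
      ¬ ∃ W : ℝ → ℝ, MemLp W ⊤ (volume.restrict (Set.Icc (0:ℝ) 1)) ∧
          (∃ κ : Kernel (ℝ × ℝ) (ℝ × ℝ), IsBistochastic μM κ ∧
            (fun x : ℝ × ℝ => W x.2) =ᵐ[μM] kernApply κ (pertVort ωb δ ε)) ∧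
          energy (fun x : ℝ × ℝ => W x.2) = energy (pertVort ωb δ ε) ∧
          momentum (fun x : ℝ × ℝ => W x.2) = momentum (pertVort ωb δ ε) := by
  obtain ⟨ω, C, hω, hC, hae⟩ := exists_measurable_bounded_ae_eq hωb
  have hωbint : Integrable ωb μM := hωb.integrable le_top
  set c := (δ * Real.exp (-3) / (3 * Real.pi)) ^ 2 / 8 with hc
  have hc0 : 0 < c := by have := Real.pi_pos; positivity
  set R := (∫ x, |ωb x| ∂μM + 4 * δ) / (2 * Real.pi) with hR
  set S := C ^ 2 * ∑' k : ℤ, 1 / (k : ℝ) ^ 2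
  obtain ⟨N, hN⟩ := (Filter.tendsto_atTop.1
    (Real.tendsto_sum_range_one_div_nat_succ_atTop.const_mul_atTop hc0) (R ^ 2 + S + 1)).exists
  refine ⟨min (1 / 4) (1 / (N + 1)), by positivity, fun ε hε hlt => ?_⟩
  have hε4 : ε ≤ 1 / 4 := (hlt.trans_le (min_le_left _ _)).le
  have hNε : N * ε ≤ 1 := by
    have h := hlt.trans_le (min_le_right _ _)
    rw [lt_div_iff₀ (by positivity)] at h
    linarith
  have hbint : Integrable (bump δ ε) μM :=
    .of_bound (measurable_bump δ ε).aestronglyMeasurable _ (.of_forall (abs_bump_le hδ ε))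
  have hξint : Integrable (pertVort ωb δ ε) μM := hωbint.add hbint
  refine ⟨by simpa [pertVort_eq_add_bump] using integral_abs_bump hδ hε hε4, ?_⟩
  rintro ⟨W, hW, ⟨κ, hκ, hWκ⟩, hE, -⟩
  have hWint : Integrable W sectionMeasure :=
    IntegrableOn.mono_set (hW.integrable le_top) Set.Ioo_subset_Icc_self
  have hL1 : ∫ y, |W y| ∂sectionMeasure ≤ R := by
    have h1 : ∫ x, |W x.2| ∂μM ≤ ∫ x, |pertVort ωb δ ε x| ∂μM := by
      have hWm : AEStronglyMeasurable (fun x : ℝ × ℝ => W x.2) μM := by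
        rw [μM, channel, Measure.volume_eq_prod, ← Measure.prod_restrict]
        exact hW.aestronglyMeasurable.comp_snd
      have hle : ∫⁻ x, ‖W x.2‖ₑ ∂μM ≤ ∫⁻ x, ‖pertVort ωb δ ε x‖ₑ ∂μM := by
        refine (lintegral_congr_ae (hWκ.fun_comp enorm)).trans_le ?_
        exact hκ.lintegral_enorm_kernApply_le hξint.aestronglyMeasurable
      have hfin : ∫⁻ x, ‖pertVort ωb δ ε x‖ₑ ∂μM ≠ ⊤ := hξint.hasFiniteIntegral.ne
      simp only [← Real.norm_eq_abs]
      rw [integral_norm_eq_lintegral_enorm hWm,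
        integral_norm_eq_lintegral_enorm hξint.aestronglyMeasurable]
      exact ENNReal.toReal_mono hfin hle
    have h2 : ∫ x, |pertVort ωb δ ε x| ∂μM ≤ ∫ x, |ωb x| ∂μM + 4 * δ := by
      rw [← integral_abs_bump hδ hε hε4, ← integral_add hωbint.abs hbint.abs]
      exact integral_mono hξint.abs (hωbint.abs.add hbint.abs) fun x => abs_add_le _ _
    rw [integral_channel_shear (fun y => |W y|)] at h1
    rw [hR, le_div_iff₀ Real.two_pi_pos]
    linarith
  have hupper := energy_shear_le hWint
  have hlower := energy_pertVort_ge hω hC hδ hε hε4 hNε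
  have hcongr : energy (pertVort ωb δ ε) = energy (pertVort ω δ ε) := by
    refine energy_congr_ae ?_
    filter_upwards [hae] with x hx
    simp only [pertVort_eq_add_bump, hx]
  rw [← hcongr, ← hE] at hlower
  have hsq : (∫ y, |W y| ∂sectionMeasure) ^ 2 ≤ R ^ 2 :=
    pow_le_pow_left₀ (integral_nonneg fun _ => abs_nonneg _) hL1 2
  have : c * ∑ i ∈ Finset.range N, 1 / ((i : ℝ) + 1) - S ≤ _ :=
    le_of_mul_le_mul_left (hlower.trans hupper) Real.pi_pos
  linarith

end
end

section
/- Let Ω be a bounded open subset of ℝ² with Lebesgue measure λ, let C > 0, and let (ω_j) ⊂ L^∞(Ω) and ω ∈ L^∞(Ω) satisfy ‖ω_j‖_{L^∞} ≤ C for all j and ‖ω‖_{L^∞} ≤ C. Let f : ℝ → ℝ be twice continuously differentiable with f''(x) ≥ 2c₀ > 0 for all x ∈ [−C, C]. If ω_j converges to ω weakly in L²(Ω) and ∫_Ω f(ω_j) dλ → ∫_Ω f(ω) dλ, then ω_j → ω strongly in L²(Ω), and moreover ω_j → ω strongly in L^p(Ω) for every 1 ≤ p < ∞. -/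
open MeasureTheory Filter

/-- Quadratic improvement of the tangent line inequality: if `f'' ≥ 2c` on a convex set `s`, then
`f` lies above each of its tangents in `s` by at least `c (a - b)²`. -/
theorem mul_sq_sub_le_of_le_deriv_deriv {s : Set ℝ} (hs : Convex ℝ s) {f : ℝ → ℝ} {c : ℝ}
    (hf : Differentiable ℝ f) (hf' : Differentiable ℝ (deriv f))
    (hc : ∀ x ∈ s, 2 * c ≤ deriv (deriv f) x) {a b : ℝ} (ha : a ∈ s) (hb : b ∈ s) :
    c * (a - b) ^ 2 ≤ f a - f b - deriv f b * (a - b) := by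
  have hg (x : ℝ) : HasDerivAt (fun x => f x - c * x ^ 2) (deriv f x - 2 * c * x) x :=
    ((hf x).hasDerivAt.sub ((hasDerivAt_pow 2 x).const_mul c)).congr_deriv (by push_cast; ring)
  have hg' (x : ℝ) :
      HasDerivAt (fun x => deriv f x - 2 * c * x) (deriv (deriv f) x - 2 * c) x :=
    ((hf' x).hasDerivAt.sub ((hasDerivAt_id x).const_mul (2 * c))).congr_deriv (by ring)
  have hconv : ConvexOn ℝ s (fun x => f x - c * x ^ 2) :=
    convexOn_of_hasDerivWithinAt2_nonneg hs
      (fun x _ => (hg x).continuousAt.continuousWithinAt)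
      (fun x _ => (hg x).hasDerivWithinAt) (fun x _ => (hg' x).hasDerivWithinAt)
      (fun x hx => sub_nonneg.2 (hc x (interior_subset hx)))
  rcases lt_trichotomy a b with h | rfl | h
  · have := hconv.slope_le_of_hasDerivAt ha hb h (hg b)
    rw [slope_def_field, div_le_iff₀ (sub_pos.2 h)] at this
    linarith
  · simp
  · have := hconv.le_slope_of_hasDerivAt hb ha h (hg b)
    rw [slope_def_field, le_div_iff₀ (sub_pos.2 h)] at this
    linarith

section

variable {α : Type*} [MeasurableSpace α] {μ : Measure α} [IsFiniteMeasure μ]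

/-- A continuous function of a bounded measurable function lies in every `L^p` space of a finite
measure. -/
theorem memLp_comp_of_abs_le {φ : ℝ → ℝ} (hφ : Continuous φ) {u : α → ℝ} (hu : Measurable u)
    {C : ℝ} (hC : ∀ x, |u x| ≤ C) (p : ENNReal) : MemLp (fun x => φ (u x)) p μ := by
  obtain ⟨K, hK⟩ := (isCompact_Icc (a := -C) (b := C)).exists_bound_of_continuousOn
    hφ.continuousOn
  exact MemLp.of_bound (hφ.measurable.comp hu).aestronglyMeasurable K
    (ae_of_all _ fun x => hK _ (abs_le.1 (hC x)))

/-- On a finite measure space, uniformly bounded functions tending to zero in `L²` tend to zero in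
`L^p` for every `1 ≤ p < ∞`. -/
theorem tendsto_integral_abs_rpow_of_tendsto_integral_sq {ι : Type*} {l : Filter ι}
    {d : ι → α → ℝ} (hd : ∀ j, Measurable (d j)) {M : ℝ} (hM : ∀ j x, |d j x| ≤ M)
    (h : Tendsto (fun j => ∫ x, d j x ^ 2 ∂μ) l (nhds 0)) {p : ℝ} (hp : 1 ≤ p) :
    Tendsto (fun j => ∫ x, |d j x| ^ p ∂μ) l (nhds 0) := by
  have habs (j : ι) (q : ENNReal) : MemLp (fun x => |d j x|) q μ :=
    memLp_comp_of_abs_le continuous_abs (hd j) (hM j) q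
  have hlim : Tendsto (fun j => M ^ (p - 1) *
      ((∫ x, d j x ^ 2 ∂μ) ^ (1 / 2 : ℝ) * (∫ _ : α, (1 : ℝ) ^ (2 : ℝ) ∂μ) ^ (1 / 2 : ℝ)))
      l (nhds 0) := by
    have := h.rpow_const (p := (1 / 2 : ℝ)) (Or.inr (by norm_num))
    rw [Real.zero_rpow (by norm_num)] at this
    simpa only [zero_mul, mul_zero] using (this.mul_const _).const_mul _
  refine squeeze_zero (fun j => integral_nonneg fun x => by positivity) (fun j => ?_) hlim
  rcases isEmpty_or_nonempty α with hα | ⟨⟨x₀⟩⟩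
  · simp [Measure.eq_zero_of_isEmpty μ]
  have hM0 : 0 ≤ M := (abs_nonneg _).trans (hM j x₀)
  calc ∫ x, |d j x| ^ p ∂μ ≤ ∫ x, M ^ (p - 1) * |d j x| ∂μ := by
        refine integral_mono_of_nonneg (ae_of_all _ fun x => by positivity)
          (((habs j 1).integrable le_rfl).const_mul _) (ae_of_all _ fun x => ?_)
        have hsplit : |d j x| ^ p = |d j x| ^ (p - 1) * |d j x| := by
          conv_rhs => rw [← Real.rpow_add_one' (abs_nonneg _) (by linarith)]
          rw [sub_add_cancel]
        simp only [hsplit]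
        gcongr
        exact hM j x
    _ = M ^ (p - 1) * ∫ x, |d j x| * 1 ∂μ := by simp only [integral_const_mul, mul_one]
    _ ≤ _ := by
        gcongr
        have := integral_mul_le_Lp_mul_Lq_of_nonneg (μ := μ) Real.HolderConjugate.two_two
          (f := fun x => |d j x|) (g := fun _ => 1) (ae_of_all _ fun x => abs_nonneg _)
          (ae_of_all _ fun x => zero_le_one) (habs j _) (memLp_const _)
        simpa only [Real.rpow_two, sq_abs] using this

end

/-- weak `L²` convergence together with convergence of a uniformly
strictly convex Casimir implies strong convergence in every `L^p`, `1 ≤ p < ∞`. -/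
theorem weak_plus_casimir_implies_strong
    (Ω : Set (ℝ × ℝ)) (hΩopen : IsOpen Ω) (hΩbdd : Bornology.IsBounded Ω)
    (C : ℝ) (hC : 0 < C)
    (ω : ℕ → ℝ × ℝ → ℝ) (ωlim : ℝ × ℝ → ℝ)
    (hmeas : ∀ j, Measurable (ω j)) (hmeaslim : Measurable ωlim)
    (hbd : ∀ j, ∀ x, |ω j x| ≤ C) (hbdlim : ∀ x, |ωlim x| ≤ C)
    (c₀ : ℝ) (hc₀ : 0 < c₀)
    (f : ℝ → ℝ) (hf : ContDiff ℝ 2 f)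
    (hf'' : ∀ x ∈ Set.Icc (-C) C, 2 * c₀ ≤ deriv (deriv f) x)
    (hweak : ∀ g : ℝ × ℝ → ℝ, MemLp g 2 (volume.restrict Ω) →
      Tendsto (fun j => ∫ x, g x * ω j x ∂(volume.restrict Ω)) atTop
        (nhds (∫ x, g x * ωlim x ∂(volume.restrict Ω))))
    (hcasimir : Tendsto (fun j => ∫ x, f (ω j x) ∂(volume.restrict Ω)) atTop
      (nhds (∫ x, f (ωlim x) ∂(volume.restrict Ω)))) :
    (Tendsto (fun j => ∫ x, (ω j x - ωlim x) ^ 2 ∂(volume.restrict Ω)) atTop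
        (nhds 0)) ∧
    ∀ p : ℝ, 1 ≤ p →
      Tendsto (fun j => ∫ x, |ω j x - ωlim x| ^ p ∂(volume.restrict Ω)) atTop
        (nhds 0) := by
  have : IsFiniteMeasure (volume.restrict Ω) :=
    isFiniteMeasure_restrict.2 hΩbdd.measure_lt_top.ne
  have hdf : Differentiable ℝ f := hf.differentiable (by norm_num)
  have hdf' : Differentiable ℝ (deriv f) := hf.differentiable_deriv_two
  have hf_int (u : ℝ × ℝ → ℝ) (hu : Measurable u) (hb : ∀ x, |u x| ≤ C) :
      Integrable (fun x => f (u x)) (volume.restrict Ω) :=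
    (memLp_comp_of_abs_le hdf.continuous hu hb 1).integrable le_rfl
  have hg : MemLp (fun x => deriv f (ωlim x)) 2 (volume.restrict Ω) :=
    memLp_comp_of_abs_le hdf'.continuous hmeaslim hbdlim 2
  have hg_int (u : ℝ × ℝ → ℝ) (hu : Measurable u) (hb : ∀ x, |u x| ≤ C) :
      Integrable (fun x => deriv f (ωlim x) * u x) (volume.restrict Ω) :=
    hg.integrable_mul (memLp_comp_of_abs_le continuous_id hu hb 2)
  have hd (j : ℕ) : Measurable fun x => ω j x - ωlim x := (hmeas j).sub hmeaslim
  have hdb (j : ℕ) (x : ℝ × ℝ) : |ω j x - ωlim x| ≤ C + C :=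
    (abs_sub _ _).trans (add_le_add (hbd j x) (hbdlim x))
  have hbound (j : ℕ) : ∫ x, (ω j x - ωlim x) ^ 2 ∂(volume.restrict Ω) ≤
      c₀⁻¹ * ((∫ x, f (ω j x) ∂(volume.restrict Ω)) - (∫ x, f (ωlim x) ∂(volume.restrict Ω)) -
        ((∫ x, deriv f (ωlim x) * ω j x ∂(volume.restrict Ω)) -
          ∫ x, deriv f (ωlim x) * ωlim x ∂(volume.restrict Ω))) := by
    have i₁ := hf_int _ (hmeas j) (hbd j)
    have i₂ := hf_int _ hmeaslim hbdlim
    have i₃ := hg_int _ (hmeas j) (hbd j)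
    have i₄ := hg_int _ hmeaslim hbdlim
    rw [← integral_sub' i₁ i₂, ← integral_sub' i₃ i₄, ← integral_sub' (i₁.sub i₂) (i₃.sub i₄),
      le_inv_mul_iff₀ hc₀, ← integral_const_mul]
    refine integral_mono_of_nonneg (ae_of_all _ fun x => by positivity)
      ((i₁.sub i₂).sub (i₃.sub i₄)) (ae_of_all _ fun x => ?_)
    have := mul_sq_sub_le_of_le_deriv_deriv (convex_Icc (-C) C) hdf hdf' hf''
      (abs_le.1 (hbd j x)) (abs_le.1 (hbdlim x))
    rwa [mul_sub] at this
  have hsq : Tendsto (fun j => ∫ x, (ω j x - ωlim x) ^ 2 ∂(volume.restrict Ω)) atTop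
      (nhds 0) := by
    refine squeeze_zero (fun j => integral_nonneg fun x => sq_nonneg _) hbound ?_
    simpa only [sub_self, mul_zero] using
      ((hcasimir.sub_const (∫ x, f (ωlim x) ∂(volume.restrict Ω))).sub ((hweak _ hg).sub_const
        (∫ x, deriv f (ωlim x) * ωlim x ∂(volume.restrict Ω)))).const_mul c₀⁻¹
  exact ⟨hsq, fun p hp => tendsto_integral_abs_rpow_of_tendsto_integral_sq hd hdb hsq hp⟩
end
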